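/- Let G and G' be simple graphs on the same finite vertex set V. Suppose G is connected and that for every vertex v ∈ V, the subgraph of G' induced on the closed neighborhood of v in G (the set consisting of v together with all vertices adjacent to v in G) is connected. Then G' is connected. -/

import Mathlib

theorem stmt_1 {V : Type*} [Fintype V] [Nonempty V] (G G' : SimpleGraph V)
    (hG : G.Connected)
    (hloc : ∀ v : V, (G'.induce (insert v (G.neighborSet v))).Connected) :
    G'.Connected := by
  have reachable_of_adj : ∀ u v : V, G.Adj u v → G'.Reachable u v := fun u v huv =>
    ((hloc u).preconnected ⟨u, Set.mem_insert _ _⟩ ⟨v, Set.mem_insert_of_mem _ huv⟩).map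
      (SimpleGraph.Embedding.induce _).toHom
  refine SimpleGraph.Connected.mk fun u v => ?_
  obtain ⟨p⟩ := hG.preconnected u v
  induction p with
  | nil => exact SimpleGraph.Reachable.refl _
  | cons h _ ih => exact (reachable_of_adj _ _ h).trans ih
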